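/- Let I ⊆ S be a squarefree monomial ideal with minimal primary decomposition I = I_{α_1} ∩ ⋯ ∩ I_{α_r}. Then for every e ≥ 0 and q = p^e, every minimal monomial generator x^γ = x_1^{γ_1}⋯x_n^{γ_n} of the monomial ideal (I^{[q]} :_S I) satisfies γ_i ∈ {0, q−1, q} for every i. -/

import Mathlib

noncomputable section

/-- The `q`-th Frobenius power of an ideal: the ideal generated by `{f^q : f ∈ I}`. -/
def frobPow {R : Type*} [CommRing R] (q : ℕ) (I : Ideal R) : Ideal R :=
  Ideal.span ((fun f => f ^ q) '' (I : Set R))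

/-- The monomial `x^γ = x_1^{γ_1} ⋯ x_n^{γ_n}` in `k[[x_1,…,x_n]]`. -/
def mon (k : Type*) [Field k] {n : ℕ} (γ : Fin n → ℕ) : MvPowerSeries (Fin n) k :=
  ∏ i, (MvPowerSeries.X i : MvPowerSeries (Fin n) k) ^ γ i

/-- The face ideal `I_α`, generated by the variables `x_i` with `α i = 1`. -/
def faceIdeal (k : Type*) [Field k] {n : ℕ} (α : Fin n → ℕ) :
    Ideal (MvPowerSeries (Fin n) k) :=
  Ideal.span {f | ∃ i, α i = 1 ∧ f = MvPowerSeries.X i}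

/-- `I = I_{α_1} ∩ ⋯ ∩ I_{α_r}` is the minimal primary decomposition of the squarefree
monomial ideal `I` into face ideals: each `α j` is a nonzero `{0,1}`-vector, `I` is the
intersection of the face ideals `I_{α j}`, and the decomposition is irredundant (the
supports of the `α j` are pairwise incomparable). -/
def IsMinFaceDecomp (k : Type*) [Field k] {n r : ℕ} (α : Fin r → Fin n → ℕ)
    (I : Ideal (MvPowerSeries (Fin n) k)) : Prop :=
  (∀ j i, α j i = 0 ∨ α j i = 1) ∧ (∀ j, α j ≠ 0) ∧
    I = ⨅ j, faceIdeal k (α j) ∧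
    ∀ j l, j ≠ l → ¬ ({i | α j i = 1} ⊆ {i | α l i = 1})

/-- `x^γ` is a minimal monomial generator of the monomial ideal `J`: `x^γ ∈ J` and no
monomial properly dividing `x^γ` belongs to `J`. -/
def IsMinGen (k : Type*) [Field k] {n : ℕ} (J : Ideal (MvPowerSeries (Fin n) k))
    (γ : Fin n → ℕ) : Prop :=
  mon k γ ∈ J ∧ ∀ δ : Fin n → ℕ, (∀ i, δ i ≤ γ i) → δ ≠ γ → mon k δ ∉ J

namespace MvPowerSeries

variable {σ R : Type*} [CommRing R]

/-- A power series lies in an ideal generated by finitely many monomials if and only if each of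
its monomials is divisible by one of the generators. -/
theorem mem_span_monomial_image_iff {s : Set (σ →₀ ℕ)} (hs : s.Finite) {f : MvPowerSeries σ R} :
    f ∈ Ideal.span ((fun a => monomial a (1 : R)) '' s) ↔
      ∀ m, coeff m f ≠ 0 → ∃ a ∈ s, a ≤ m := by
  classical
  induction s, hs using Set.Finite.induction_on generalizing f with
  | empty =>
    simp only [Set.image_empty, Ideal.span_empty, Ideal.mem_bot, Set.mem_empty_iff_false,
      false_and, exists_false, imp_false, not_not]
    exact MvPowerSeries.ext_iff
  | @insert a s _ _ ih =>
    rw [Set.image_insert_eq, Ideal.mem_span_insert]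
    constructor
    · rintro ⟨g, h, hh, rfl⟩ m hm
      by_cases ham : a ≤ m
      · exact ⟨a, Set.mem_insert _ _, ham⟩
      · rw [map_add, mul_comm, coeff_monomial_mul, if_neg ham, zero_add] at hm
        obtain ⟨b, hb, hbm⟩ := ih.1 hh m hm
        exact ⟨b, Set.mem_insert_of_mem _ hb, hbm⟩
    · intro hf
      let g : MvPowerSeries σ R := fun m => coeff (a + m) f
      refine ⟨g, f - g * monomial a 1, ih.2 fun m hm => ?_, by ring⟩
      rw [map_sub, mul_comm, coeff_monomial_mul] at hm
      have hg (m : σ →₀ ℕ) : coeff m g = coeff (a + m) f := rfl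
      by_cases ham : a ≤ m
      · simp [ham, hg, add_tsub_cancel_of_le ham] at hm
      · rw [if_neg ham, sub_zero] at hm
        obtain ⟨b, rfl | hb, hbm⟩ := hf m hm
        · exact absurd hbm ham
        · exact ⟨b, hb, hbm⟩

theorem monomial_one_mem_span_monomial_image_iff [Nontrivial R] {s : Set (σ →₀ ℕ)}
    (hs : s.Finite) {m : σ →₀ ℕ} :
    monomial m (1 : R) ∈ Ideal.span ((fun a => monomial a (1 : R)) '' s) ↔ ∃ a ∈ s, a ≤ m := by
  classical
  rw [mem_span_monomial_image_iff hs]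
  simp [coeff_monomial]

theorem charP_of_charP (p : ℕ) [CharP R p] : CharP (MvPowerSeries σ R) p :=
  charP_of_injective_ringHom (f := C) C_injective p

theorem monomial_one_pow (a : σ →₀ ℕ) (q : ℕ) :
    monomial a (1 : R) ^ q = monomial (q • a) 1 := by
  induction q with
  | zero => simp
  | succ q ih => rw [pow_succ, ih, monomial_mul_monomial, succ_nsmul, mul_one]

end MvPowerSeries

open MvPowerSeries

theorem frobPow_span {R : Type*} [CommRing R] (p : ℕ) [Fact p.Prime] [CharP R p] (e : ℕ)
    (s : Set R) : frobPow (p ^ e) (Ideal.span s) = Ideal.span ((· ^ p ^ e) '' s) := by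
  have := expChar_prime R p
  exact Ideal.map_span (iterateFrobenius R p e) s

theorem mon_eq_monomial (k : Type*) [Field k] {n : ℕ} (γ : Fin n → ℕ) :
    mon k γ = monomial (Finsupp.equivFunOnFinite.symm γ) 1 := by
  rw [monomial_eq', map_one, one_mul, Finsupp.prod_fintype _ _ (fun _ => pow_zero _)]
  rfl

theorem mem_faceIdeal_iff {k : Type*} [Field k] {n : ℕ} {α : Fin n → ℕ}
    {f : MvPowerSeries (Fin n) k} :
    f ∈ faceIdeal k α ↔ ∀ m, coeff m f ≠ 0 → ∃ i, α i = 1 ∧ 1 ≤ m i := by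
  have h : faceIdeal k α = Ideal.span ((fun a => monomial a (1 : k)) ''
      ((fun i => Finsupp.single i 1) '' {i | α i = 1})) := by
    rw [faceIdeal, Set.image_image]
    congr 1
    ext f
    simp [X, eq_comm]
  rw [h, mem_span_monomial_image_iff ((Set.toFinite _).image _)]
  simp

/-- The exponents of the squarefree monomials lying in every face ideal `I_{α j}`. -/
def transversals {n r : ℕ} (α : Fin r → Fin n → ℕ) : Set (Fin n →₀ ℕ) :=
  {t | (∀ i, t i ≤ 1) ∧ ∀ j, ∃ i, α j i = 1 ∧ t i = 1}

theorem finite_transversals {n r : ℕ} (α : Fin r → Fin n → ℕ) : (transversals α).Finite :=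
  (Set.finite_Iic (Finsupp.equivFunOnFinite.symm fun _ => 1)).subset fun _ ht => ht.1

theorem exists_transversal_smul_le_iff {n r : ℕ} {α : Fin r → Fin n → ℕ} {q : ℕ}
    {m : Fin n →₀ ℕ} :
    (∃ t ∈ transversals α, q • t ≤ m) ↔ ∀ j, ∃ i, α j i = 1 ∧ q ≤ m i := by
  constructor
  · rintro ⟨t, ht, htm⟩ j
    obtain ⟨i, hi, hti⟩ := ht.2 j
    exact ⟨i, hi, by simpa [hti] using htm i⟩
  · intro h
    refine ⟨Finsupp.equivFunOnFinite.symm fun i => if q ≤ m i then 1 else 0,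
      ⟨fun i => ?_, fun j => ?_⟩, fun i => ?_⟩
    · simp only [Finsupp.coe_equivFunOnFinite_symm]
      split_ifs <;> simp
    · obtain ⟨i, hi, hm⟩ := h j
      exact ⟨i, hi, by simp [hm]⟩
    · by_cases hm : q ≤ m i <;> simp [hm]

theorem iInf_faceIdeal_eq_span {k : Type*} [Field k] {n r : ℕ} (α : Fin r → Fin n → ℕ) :
    ⨅ j, faceIdeal k (α j) =
      Ideal.span ((fun t => monomial t (1 : k)) '' transversals α) := by
  ext f
  simp only [Ideal.mem_iInf, mem_faceIdeal_iff,
    mem_span_monomial_image_iff (finite_transversals α)]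
  rw [forall_comm]
  refine forall_congr' fun m => ?_
  rw [forall_comm]
  refine forall_congr' fun _ => ?_
  simpa using (exists_transversal_smul_le_iff (q := 1) (m := m) (α := α)).symm

theorem mon_mem_colon_iff (p : ℕ) [Fact p.Prime] {k : Type*} [Field k] [CharP k p] {n r : ℕ}
    (α : Fin r → Fin n → ℕ) (e : ℕ) (γ : Fin n → ℕ) :
    mon k γ ∈ (frobPow (p ^ e) (⨅ j, faceIdeal k (α j))).colon
        (⨅ j, faceIdeal k (α j) : Ideal (MvPowerSeries (Fin n) k)) ↔
      ∀ t ∈ transversals α, ∀ j, ∃ i, α j i = 1 ∧ p ^ e ≤ γ i + t i := by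
  have : CharP (MvPowerSeries (Fin n) k) p := charP_of_charP p
  rw [iInf_faceIdeal_eq_span, Ideal.colon_span, frobPow_span, Set.image_image,
    Submodule.mem_colon, Set.forall_mem_image]
  refine forall₂_congr fun t _ => ?_
  have himg : (fun t => monomial t (1 : k) ^ p ^ e) '' transversals α =
      (fun a => monomial a (1 : k)) '' ((p ^ e • ·) '' transversals α) := by
    rw [Set.image_image]
    simp only [monomial_one_pow]
  rw [himg, mon_eq_monomial, smul_eq_mul, monomial_mul_monomial, one_mul,
    monomial_one_mem_span_monomial_image_iff ((finite_transversals α).image _),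
    Set.exists_mem_image, exists_transversal_smul_le_iff]
  rfl

theorem statement4 (p : ℕ) [Fact p.Prime] (k : Type*) [Field k] [CharP k p]
    (n : ℕ) (hn : 0 < n) (r : ℕ) (hr : 0 < r) (α : Fin r → Fin n → ℕ)
    (I : Ideal (MvPowerSeries (Fin n) k)) (hdec : IsMinFaceDecomp k α I) (e : ℕ)
    (γ : Fin n → ℕ) (hγ : IsMinGen k ((frobPow (p ^ e) I).colon I) γ) :
    ∀ i, γ i = 0 ∨ γ i = p ^ e - 1 ∨ γ i = p ^ e := by
  obtain ⟨-, -, rfl, -⟩ := hdec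
  obtain ⟨hmem, hmin⟩ := hγ
  rw [mon_mem_colon_iff] at hmem
  intro i
  by_contra! hi
  obtain ⟨c, hc, hcγ⟩ : ∃ c < γ i, ∀ b ≤ 1, p ^ e ≤ γ i + b → p ^ e ≤ c + b := by
    by_cases hlt : γ i < p ^ e
    · exact ⟨0, by omega, by omega⟩
    · exact ⟨p ^ e, by omega, by omega⟩
  refine hmin (Function.update γ i c) (fun l => ?_) (fun h => ?_)
    ((mon_mem_colon_iff p α e _).2 fun t ht j => ?_)
  · by_cases hl : l = i
    · subst hl
      simpa using hc.le
    · simp [hl]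
  · have := congrFun h i
    simp only [Function.update_self] at this
    omega
  · obtain ⟨l, hl, hle⟩ := hmem t ht j
    refine ⟨l, hl, ?_⟩
    by_cases hli : l = i
    · subst hli
      simpa using hcγ _ (ht.1 l) hle
    · simpa [hli] using hle

end
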